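/- Suppose φ : ℝ² → ℝ is continuously differentiable and satisfies x·φ_x(x,y) + y·φ_y(x,y) ≥ 0 for all (x,y) ∈ ℝ². If the planar system (S): ẋ = y, ẏ = −x − y·φ(x,y) has two distinct limit cycles μ₁ and μ₂ (which are then necessarily concentric, surrounding the unique critical point O = (0,0); let μ₁ be the inner one and μ₂ the outer one), then the function A(x,y) = x² + y² + x·y·φ(x,y) is strictly positive at every point of the closed annular region D₁₂ bounded by the orbits of μ₁ and μ₂. -/

import Mathlib

open Set Filter Metric Real Topology intervalIntegral

noncomputable section

/-- `γ` solves the planar ODE with vector field `F` at every time in `s`. -/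
def IsSolOn (F : ℝ × ℝ → ℝ × ℝ) (γ : ℝ → ℝ × ℝ) (s : Set ℝ) : Prop :=
  ∀ t ∈ s, HasDerivAt γ (F (γ t)) t

/-- A cycle: a non-constant `T`-periodic solution (with `T > 0`). -/
def IsCycle (F : ℝ × ℝ → ℝ × ℝ) (γ : ℝ → ℝ × ℝ) (T : ℝ) : Prop :=
  (∀ t, HasDerivAt γ (F (γ t)) t) ∧ 0 < T ∧ (∀ t, γ (t + T) = γ t) ∧
    ∃ t₁ t₂, γ t₁ ≠ γ t₂

/-- A limit cycle: a cycle whose orbit has a neighbourhood containing no orbit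
of any other cycle. -/
def IsLimitCycle (F : ℝ × ℝ → ℝ × ℝ) (γ : ℝ → ℝ × ℝ) (T : ℝ) : Prop :=
  IsCycle F γ T ∧
    ∃ U : Set (ℝ × ℝ), IsOpen U ∧ range γ ⊆ U ∧
      ∀ (γ' : ℝ → ℝ × ℝ) (T' : ℝ), IsCycle F γ' T' →
        range γ' ≠ range γ → ¬ range γ' ⊆ U

/-- There is a non-trivial positive semi-orbit of the system contained in `Z`. -/
def HasSemiOrbitIn (F : ℝ × ℝ → ℝ × ℝ) (Z : Set (ℝ × ℝ)) : Prop :=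
  ∃ (γ : ℝ → ℝ × ℝ) (t₀ : ℝ), IsSolOn F γ (Ici t₀) ∧
    (∃ t₁ ∈ Ici t₀, ∃ t₂ ∈ Ici t₀, γ t₁ ≠ γ t₂) ∧ γ '' Ici t₀ ⊆ Z

/-- There is a non-trivial (full) orbit of the system contained in `Z`. -/
def HasOrbitIn (F : ℝ × ℝ → ℝ × ℝ) (Z : Set (ℝ × ℝ)) : Prop :=
  ∃ γ : ℝ → ℝ × ℝ, (∀ t, HasDerivAt γ (F (γ t)) t) ∧
    (∃ t₁ t₂, γ t₁ ≠ γ t₂) ∧ range γ ⊆ Z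

/-- The vector field of system (S): ẋ = y, ẏ = −x − y·φ(x,y). -/
def phiVF (φ : ℝ × ℝ → ℝ) : ℝ × ℝ → ℝ × ℝ :=
  fun p => (p.2, -p.1 - p.2 * φ p)

/-- The (open) region enclosed by a curve `Γ`: points not on `Γ` whose connected
component in the complement of `Γ` is bounded. -/
def innerRegion (Γ : Set (ℝ × ℝ)) : Set (ℝ × ℝ) :=
  {p | p ∉ Γ ∧ Bornology.IsBounded (connectedComponentIn Γᶜ p)}


lemma aux_sqmax (s : ℝ) : HasDerivAt (fun s : ℝ => (max s 0) ^ 2) (2 * max s 0) s := by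
  rcases lt_trichotomy s 0 with h | h | h
  · have : (fun s : ℝ => (max s 0) ^ 2) =ᶠ[𝓝 s] fun _ => 0 := by
      filter_upwards [Iio_mem_nhds h] with r hr
      rw [max_eq_right (le_of_lt hr)]; norm_num
    rw [max_eq_right h.le, mul_zero]
    exact (hasDerivAt_const s (0:ℝ)).congr_of_eventuallyEq this
  · subst h
    rw [hasDerivAt_iff_isLittleO]
    have h1 : (fun r : ℝ => (max r 0) ^ 2) =O[𝓝 0] fun r : ℝ => r ^ 2 := by
      refine Asymptotics.IsBigO.of_bound 1 (Eventually.of_forall fun r => ?_)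
      rw [Real.norm_of_nonneg (sq_nonneg _), Real.norm_of_nonneg (sq_nonneg _), one_mul]
      rcases le_total r 0 with h | h
      · rw [max_eq_right h]; nlinarith [sq_nonneg r]
      · rw [max_eq_left h]
    have h2 := h1.trans_isLittleO (Asymptotics.isLittleO_pow_id (𝕜 := ℝ) (n := 2) (by norm_num))
    simpa using h2
  · have : (fun s : ℝ => (max s 0) ^ 2) =ᶠ[𝓝 s] fun s => s ^ 2 := by
      filter_upwards [Ioi_mem_nhds h] with r hr
      rw [max_eq_left (le_of_lt hr)]
    rw [max_eq_left h.le]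
    have h2 := (hasDerivAt_pow 2 s).congr_of_eventuallyEq this
    simpa using h2

lemma aux_sqmax_comp {u : ℝ → ℝ} {u' t : ℝ} (h : HasDerivAt u u' t) :
    HasDerivAt (fun t => (max (u t) 0) ^ 2) (2 * max (u t) 0 * u') t :=
  (aux_sqmax (u t)).comp t h

lemma aux_gronwall {W W' : ℝ → ℝ} (C t₀ : ℝ) (hW : ∀ t, HasDerivAt W (W' t) t)
    (hb : ∀ t, - W' t ≤ C * W t) (h0 : ∀ t, 0 ≤ W t) (ht : W t₀ = 0) :
    ∀ t ≤ t₀, W t = 0 := by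
  have hd : ∀ t, HasDerivAt (fun t => W t * Real.exp (C * t))
      (W' t * Real.exp (C * t) + W t * (Real.exp (C * t) * (C * 1))) t := fun t =>
    (hW t).mul (((hasDerivAt_id t).const_mul C).exp)
  have hmono : Monotone (fun t => W t * Real.exp (C * t)) := by
    refine monotone_of_deriv_nonneg (fun t => (hd t).differentiableAt) fun t => ?_
    rw [(hd t).deriv]
    have := hb t
    have h3 := Real.exp_pos (C * t)
    nlinarith
  intro t htt
  have h1 := hmono htt
  simp only [ht, zero_mul] at h1
  have := Real.exp_pos (C * t)
  have h2 := h0 t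
  by_contra hne
  have : 0 < W t := lt_of_le_of_ne h2 (Ne.symm hne)
  have : 0 < W t * Real.exp (C * t) := by positivity
  linarith

lemma aux_periodic_bdd {f : ℝ → ℝ} {T : ℝ} (hT : 0 < T) (hp : Function.Periodic f T)
    (hf : Continuous f) : ∃ R > 0, ∀ t, |f t| ≤ R := by
  have hc := hp.compact_of_continuous hT.ne' hf
  obtain ⟨R, hR0, hR⟩ := hc.isBounded.exists_pos_norm_le
  exact ⟨R, hR0, fun t => hR _ (mem_range_self t)⟩

lemma aux_lip {φ : ℝ × ℝ → ℝ} (hφ : ContDiff ℝ 1 φ) (R : ℝ) : ∃ K : ℝ, 0 ≤ K ∧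
    (∀ a b : ℝ, |a| ≤ R → |b| ≤ R → |φ (a, b)| ≤ K) ∧
    (∀ a b c d : ℝ, |a| ≤ R → |b| ≤ R → |c| ≤ R → |d| ≤ R →
      |φ (a, b) - φ (c, d)| ≤ K * (|a - c| + |b - d|)) := by
  obtain ⟨L, hL⟩ := (hφ.contDiffOn (s := closedBall (0 : ℝ × ℝ) R)).exists_lipschitzOnWith
    (by norm_num) (convex_closedBall _ _) (isCompact_closedBall _ _)
  obtain ⟨M, hM⟩ := (isCompact_closedBall (0 : ℝ × ℝ) R).exists_bound_of_continuousOn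
    hφ.continuous.continuousOn
  have hmem : ∀ a b : ℝ, |a| ≤ R → |b| ≤ R → (a, b) ∈ closedBall (0 : ℝ × ℝ) R := by
    intro a b ha hb
    rw [mem_closedBall_zero_iff, Prod.norm_def]
    exact max_le ha hb
  refine ⟨max L (max M 0), le_max_of_le_right (le_max_right _ _), ?_, ?_⟩
  · intro a b ha hb
    exact (hM _ (hmem a b ha hb)).trans (le_max_of_le_right (le_max_left _ _))
  · intro a b c d ha hb hc hd
    have h := hL.dist_le_mul _ (hmem a b ha hb) _ (hmem c d hc hd)
    rw [Real.dist_eq, Prod.dist_eq, Real.dist_eq, Real.dist_eq] at h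
    refine h.trans ?_
    have h1 : max |a - c| |b - d| ≤ |a - c| + |b - d| :=
      max_le (by linarith [abs_nonneg (b - d)]) (by linarith [abs_nonneg (a - c)])
    exact mul_le_mul (le_max_left _ _) h1 (le_max_of_le_left (abs_nonneg _))
      (le_max_of_le_left L.2)

lemma aux_mono {φ : ℝ × ℝ → ℝ} (hφ : ContDiff ℝ 1 φ)
    (hstar : ∀ p : ℝ × ℝ,
      p.1 * fderiv ℝ φ p (1, 0) + p.2 * fderiv ℝ φ p (0, 1) ≥ 0)
    (a b s : ℝ) (hs : 0 ≤ s) (hs1 : s ≤ 1) : φ (s * a, s * b) ≤ φ (a, b) := by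
  have hd : ∀ r : ℝ, HasDerivAt (fun r : ℝ => φ (r * a, r * b))
      (fderiv ℝ φ (r * a, r * b) (a, b)) r := by
    intro r
    have h1 : HasDerivAt (fun r : ℝ => (r * a, r * b)) (a, b) r := by
      have h1 := (hasDerivAt_id r).mul_const a
      have h2 := (hasDerivAt_id r).mul_const b
      simpa using h1.prodMk h2
    exact ((hφ.differentiable (by norm_num)) (r * a, r * b)).hasFDerivAt.comp_hasDerivAt r h1
  have hm : MonotoneOn (fun r : ℝ => φ (r * a, r * b)) (Ici 0) := by
    refine monotoneOn_of_deriv_nonneg (convex_Ici 0)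
      (fun r _ => (hd r).continuousAt.continuousWithinAt)
      (fun r _ => (hd r).differentiableAt.differentiableWithinAt) ?_
    intro r hr
    rw [interior_Ici, mem_Ioi] at hr
    rw [(hd r).deriv]
    have h := hstar (r * a, r * b)
    have e : ((a, b) : ℝ × ℝ) = a • ((1, 0) : ℝ × ℝ) + b • ((0, 1) : ℝ × ℝ) := by
      simp
    rw [e, map_add, map_smul, map_smul, smul_eq_mul, smul_eq_mul]
    simp only at h
    have h' : 0 ≤ r * (a * fderiv ℝ φ (r * a, r * b) (1, 0) + b * fderiv ℝ φ (r * a, r * b) (0, 1)) := by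
      linarith
    exact nonneg_of_mul_nonneg_right h' hr
  have := hm hs (mem_Ici.2 zero_le_one) hs1
  simpa using this

lemma aux_contra {x y : ℝ → ℝ} {T t₀ : ℝ} (hT : 0 < T)
    (hx : ∀ t, HasDerivAt x (y t) t)
    (px : Function.Periodic x T) (py : Function.Periodic y T)
    (h : ∀ t ≤ t₀, 0 ≤ y t) (h0 : 0 < y t₀) : False := by
  have hall : ∀ t, 0 ≤ y t := by
    intro t
    obtain ⟨n, hn⟩ := exists_nat_ge ((t - t₀) / T)
    rw [← py.sub_nsmul_eq n]
    apply h
    rw [div_le_iff₀ hT] at hn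
    rw [nsmul_eq_mul]; linarith
  have hmono : Monotone x := monotone_of_deriv_nonneg (fun t => (hx t).differentiableAt)
    fun t => by rw [(hx t).deriv]; exact hall t
  have he : x =ᶠ[𝓝 t₀] fun _ => x t₀ := by
    filter_upwards [Icc_mem_nhds (show t₀ - T < t₀ by linarith) (show t₀ < t₀ + T by linarith)] with t ht
    rcases le_total t t₀ with h1 | h1
    · refine le_antisymm (hmono h1) ?_
      have := hmono ht.1
      rwa [px.sub_eq] at this
    · refine le_antisymm ?_ (hmono h1)
      have := hmono ht.2
      rwa [px t₀] at this
  have := (hx t₀).unique ((hasDerivAt_const t₀ (x t₀)).congr_of_eventuallyEq he)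
  linarith

set_option maxHeartbeats 2000000 in
lemma aux_Q1 {φ : ℝ × ℝ → ℝ} (hφ : ContDiff ℝ 1 φ)
    (hm : ∀ a b s : ℝ, 0 ≤ s → s ≤ 1 → φ (s * a, s * b) ≤ φ (a, b))
    {x y : ℝ → ℝ} {T t₀ : ℝ} (hT : 0 < T)
    (hx : ∀ t, HasDerivAt x (y t) t)
    (hy : ∀ t, HasDerivAt y (- x t - y t * φ (x t, y t)) t)
    (px : Function.Periodic x T) (py : Function.Periodic y T)
    (hx0 : 0 < x t₀) (hy0 : 0 < y t₀)
    (hA : x t₀ ^ 2 + y t₀ ^ 2 + x t₀ * y t₀ * φ (x t₀, y t₀) ≤ 0) : False := by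
  obtain ⟨R₁, hR₁, hxR⟩ := aux_periodic_bdd hT px
    (continuous_iff_continuousAt.2 fun t => (hx t).continuousAt)
  obtain ⟨R₂, hR₂, hyR⟩ := aux_periodic_bdd hT py
    (continuous_iff_continuousAt.2 fun t => (hy t).continuousAt)
  obtain ⟨m, hmq⟩ : ∃ m, m = y t₀ / x t₀ := ⟨_, rfl⟩
  have hmp : 0 < m := by rw [hmq]; positivity
  have hyq : y t₀ = m * x t₀ := by rw [hmq]; field_simp
  obtain ⟨q, hq⟩ : ∃ q, q = x t₀ := ⟨_, rfl⟩
  rw [hyq, ← hq] at hA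
  rw [← hq] at hx0 hyq
  obtain ⟨K, hK0, hKb, hKl⟩ := aux_lip hφ (R₁ + R₂ + m * R₁)
  have hmR : 0 < m * R₁ := by positivity
  have hPq : 1 + m ^ 2 + m * φ (q, m * q) ≤ 0 := by
    have : q ^ 2 * (1 + m ^ 2 + m * φ (q, m * q)) ≤ 0 := by nlinarith
    by_contra hc
    push Not at hc
    have : 0 < q ^ 2 * (1 + m ^ 2 + m * φ (q, m * q)) := by positivity
    linarith
  have hP0 : ∀ ξ, 0 ≤ ξ → ξ ≤ q → 1 + m ^ 2 + m * φ (ξ, m * ξ) ≤ 0 := by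
    intro ξ h1 h2
    have := hm q (m * q) (ξ / q) (by positivity) ((div_le_one hx0).2 h2)
    have e1 : ξ / q * q = ξ := by field_simp
    have e2 : ξ / q * (m * q) = m * ξ := by field_simp
    rw [e1, e2] at this
    nlinarith
  obtain ⟨B, hB⟩ : ∃ B, B = 1 + m ^ 2 + m * K := ⟨_, rfl⟩
  have hB0 : 0 < B := by rw [hB]; positivity
  obtain ⟨G, hG⟩ : ∃ G, G = R₁ * (m * K * (1 + m)) + B / m := ⟨_, rfl⟩
  have hBm : 0 ≤ B / m := by positivity
  have hG1 : 0 ≤ R₁ * (m * K * (1 + m)) := by positivity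
  have key : ∀ t ≤ t₀, (max (y t - m * x t) 0) ^ 2 + (max (x t - q) 0) ^ 2
      + (max (- y t) 0) ^ 2 = 0 := by
    refine aux_gronwall (2 * (G * 3 + K + m + 1 + 2 / m + K)) t₀
      (W' := fun t => 2 * max (y t - m * x t) 0 * ((- x t - y t * φ (x t, y t)) - m * y t)
        + 2 * max (x t - q) 0 * (y t) + 2 * max (- y t) 0 * (-(- x t - y t * φ (x t, y t)))) ?_ ?_ ?_ ?_
    · intro t
      exact ((aux_sqmax_comp ((hy t).sub ((hx t).const_mul m))).add
        (aux_sqmax_comp ((hx t).sub_const q))).add (aux_sqmax_comp (hy t).neg)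
    · intro t
      have hKt := hKb (x t) (y t) (by linarith [hxR t]) (by linarith [hyR t])
      have hxt := hxR t
      have hLt := fun c => hKl (x t) (y t) c (m * c) (by linarith [hxR t]) (by linarith [hyR t])
      generalize x t = X at *
      generalize y t = Y at *
      obtain ⟨f, hf⟩ : ∃ f, f = φ (X, Y) := ⟨_, rfl⟩
      rw [← hf] at hKt hLt ⊢
      obtain ⟨D, hD⟩ : ∃ D, D = max (Y - m * X) 0 := ⟨_, rfl⟩
      obtain ⟨E, hE⟩ : ∃ E, E = max (X - q) 0 := ⟨_, rfl⟩
      obtain ⟨F, hF⟩ : ∃ F, F = max (- Y) 0 := ⟨_, rfl⟩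
      rw [← hD, ← hE, ← hF]
      have hD0 : 0 ≤ D := hD ▸ le_max_right _ _
      have hE0 : 0 ≤ E := hE ▸ le_max_right _ _
      have hF0 : 0 ≤ F := hF ▸ le_max_right _ _
      have hD1 : Y - m * X ≤ D := hD ▸ le_max_left _ _
      have hE1 : X - q ≤ E := hE ▸ le_max_left _ _
      have hF1 : - Y ≤ F := hF ▸ le_max_left _ _
      have hDu : D * (Y - m * X) = D ^ 2 := by
        rcases le_total (Y - m * X) 0 with h | h
        · rw [hD, max_eq_right h]; ring
        · rw [hD, max_eq_left h]; ring
      have hFu : F * Y = - F ^ 2 := by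
        rcases le_total (- Y) 0 with h | h
        · rw [hF, max_eq_right h]; ring
        · rw [hF, max_eq_left h]; ring
      have hxm : - X ≤ (D + F) / m := by
        rw [le_div_iff₀ hmp]; linarith
      have hfa := abs_le.1 hKt
      have hE2 : - (E * Y) ≤ E * F := by linarith [mul_le_mul_of_nonneg_left hF1 hE0]
      have hF2 : F * (- X - Y * f) ≤ F * ((D + F) / m) + K * F ^ 2 := by
        have h1 : F * (-X) ≤ F * ((D + F) / m) := mul_le_mul_of_nonneg_left hxm hF0
        have h2 : F * (- X - Y * f) = F * (-X) + f * F ^ 2 := by linear_combination (-f) * hFu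
        have h3 : f * F ^ 2 ≤ K * F ^ 2 := mul_le_mul_of_nonneg_right hfa.2 (sq_nonneg _)
        linarith
      have hXP : D * (X * (1 + m ^ 2 + m * f)) ≤ D * (G * (D + E + F)) := by
        rcases hD0.eq_or_lt with h0 | hDpos
        · rw [← h0]; simp
        have hDeq : Y - m * X = D := by
          have : D * (Y - m * X - D) = 0 := by linear_combination hDu
          rcases mul_eq_zero.1 this with h | h <;> linarith
        apply mul_le_mul_of_nonneg_left _ hD0
        rcases le_total 0 X with hX | hX
        · have hR1X : X ≤ R₁ := (le_abs_self X).trans hxt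
          have hξ : X - min X q = E := by
            rcases le_total X q with h | h
            · rw [min_eq_left h, hE, max_eq_right (by linarith)]; ring
            · rw [min_eq_right h, hE, max_eq_left (by linarith)]
          have hξ0 : 0 ≤ min X q := le_min hX hx0.le
          have hξ1 : min X q ≤ q := min_le_right _ _
          have hξ2 : min X q ≤ X := min_le_left _ _
          generalize min X q = ξ at *
          have hl := hLt ξ (by rw [abs_of_nonneg hξ0]; linarith)
            (by
              rw [abs_of_nonneg (by positivity)]
              linarith [mul_le_mul_of_nonneg_left (hξ2.trans hR1X) hmp.le])
          have hp := hP0 ξ hξ0 hξ1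
          have e1 : |X - ξ| = E := by rw [hξ, abs_of_nonneg hE0]
          have e2 : |Y - m * ξ| ≤ D + m * E := by
            have : Y - m * ξ = D + m * E := by linear_combination hDeq + m * hξ
            rw [this, abs_of_nonneg (by positivity)]
          have h1 : f - φ (ξ, m * ξ) ≤ K * (E + (D + m * E)) := by
            refine (le_abs_self _).trans (hl.trans ?_)
            rw [e1]
            exact mul_le_mul_of_nonneg_left (by linarith) hK0
          have h2 : 1 + m ^ 2 + m * f ≤ m * (K * (E + (D + m * E))) := by
            linarith [mul_le_mul_of_nonneg_left h1 hmp.le]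
          have h3 : m * (K * (E + (D + m * E))) ≤ m * K * (1 + m) * (D + E + F) := by
            have : 0 ≤ m * K := by positivity
            have h4 : E + (D + m * E) ≤ (1 + m) * (D + E + F) := by
              linarith [mul_nonneg hmp.le hD0, mul_nonneg hmp.le hF0]
            calc m * (K * (E + (D + m * E))) = m * K * (E + (D + m * E)) := by ring
              _ ≤ m * K * ((1 + m) * (D + E + F)) := mul_le_mul_of_nonneg_left h4 this
              _ = _ := by ring
          have h5 : 0 ≤ m * K * (1 + m) * (D + E + F) := by positivity
          calc X * (1 + m ^ 2 + m * f) ≤ X * (m * K * (1 + m) * (D + E + F)) :=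
                mul_le_mul_of_nonneg_left (h2.trans h3) hX
            _ ≤ R₁ * (m * K * (1 + m) * (D + E + F)) := mul_le_mul_of_nonneg_right hR1X h5
            _ ≤ G * (D + E + F) := by
                rw [hG]
                have : 0 ≤ B / m * (D + E + F) := by positivity
                linarith
        · have h1 : -(1 + m ^ 2 + m * f) ≤ B := by
            rw [hB]
            linarith [mul_le_mul_of_nonneg_left hfa.1 hmp.le, mul_le_mul_of_nonneg_left hfa.2 hmp.le, sq_nonneg m]
          calc X * (1 + m ^ 2 + m * f) = (- X) * (-(1 + m ^ 2 + m * f)) := by ring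
            _ ≤ (-X) * B := mul_le_mul_of_nonneg_left h1 (by linarith)
            _ ≤ ((D + F) / m) * B := mul_le_mul_of_nonneg_right hxm hB0.le
            _ = B / m * (D + F) := by ring
            _ ≤ G * (D + E + F) := by
                rw [hG]
                have h2 : 0 ≤ R₁ * (m * K * (1 + m)) * (D + E + F) := by positivity
                have h3 : 0 ≤ B / m * E := by positivity
                linarith
      have hDm : - (D * ((- X - Y * f) - m * Y)) ≤ D * (G * (D + E + F)) + (K + m) * D ^ 2 := by
        have h1 : - (D * ((- X - Y * f) - m * Y)) =
            D * (X * (1 + m ^ 2 + m * f)) + (f + m) * D ^ 2 := by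
          linear_combination (f + m) * hDu
        have h2 : (f + m) * D ^ 2 ≤ (K + m) * D ^ 2 :=
          mul_le_mul_of_nonneg_right (by linarith) (sq_nonneg _)
        linarith
      have hGn : 0 ≤ G := by rw [hG]; linarith
      have s1 : D * (G * (D + E + F)) ≤ G * 3 * (D ^ 2 + E ^ 2 + F ^ 2) := by
        have : D * (D + E + F) ≤ 3 * (D ^ 2 + E ^ 2 + F ^ 2) := by
          nlinarith [sq_nonneg (D - E), sq_nonneg (D - F), sq_nonneg E, sq_nonneg F, sq_nonneg D]
        linarith [mul_le_mul_of_nonneg_left this hGn]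
      have s2 : E * F ≤ 1 * (D ^ 2 + E ^ 2 + F ^ 2) := by
        nlinarith [sq_nonneg (E - F), sq_nonneg D, sq_nonneg E, sq_nonneg F]
      have s3 : F * ((D + F) / m) ≤ 2 / m * (D ^ 2 + E ^ 2 + F ^ 2) := by
        have h1 : F * (D + F) ≤ 2 * (D ^ 2 + E ^ 2 + F ^ 2) := by
          nlinarith [sq_nonneg (D - F), sq_nonneg D, sq_nonneg E, sq_nonneg F]
        calc F * ((D + F) / m) = (F * (D + F)) / m := by ring
          _ ≤ (2 * (D ^ 2 + E ^ 2 + F ^ 2)) / m := by gcongr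
          _ = _ := by ring
      have s4 : (K + m) * D ^ 2 ≤ (K + m) * (D ^ 2 + E ^ 2 + F ^ 2) :=
        mul_le_mul_of_nonneg_left (by nlinarith [sq_nonneg E, sq_nonneg F]) (by linarith)
      have s5 : K * F ^ 2 ≤ K * (D ^ 2 + E ^ 2 + F ^ 2) :=
        mul_le_mul_of_nonneg_left (by nlinarith [sq_nonneg E, sq_nonneg D]) (by linarith)
      linarith only [s1, s2, s3, s4, s5, hDm, hE2, hF2]
    · intro t; positivity
    · rw [hyq, ← hq]
      have : (-(m * q)) ≤ 0 := by nlinarith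
      simp [max_eq_right this]
  refine aux_contra hT hx px py (t₀ := t₀) (fun t ht => ?_) hy0
  have h := key t ht
  have h3 : (max (- y t) 0) ^ 2 = 0 := by
    have := sq_nonneg (max (y t - m * x t) 0)
    have := sq_nonneg (max (x t - q) 0)
    have := sq_nonneg (max (- y t) 0)
    linarith
  have h4 : max (- y t) 0 = 0 := by simpa using h3
  have := le_max_left (- y t) 0
  linarith

set_option maxHeartbeats 2000000 in
lemma aux_Q2 {φ : ℝ × ℝ → ℝ} (hφ : ContDiff ℝ 1 φ)
    (hm : ∀ a b s : ℝ, 0 ≤ s → s ≤ 1 → φ (s * a, s * b) ≤ φ (a, b))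
    {x y : ℝ → ℝ} {T t₀ : ℝ} (hT : 0 < T)
    (hx : ∀ t, HasDerivAt x (y t) t)
    (hy : ∀ t, HasDerivAt y (- x t - y t * φ (x t, y t)) t)
    (px : Function.Periodic x T) (py : Function.Periodic y T)
    (hx0 : x t₀ < 0) (hy0 : 0 < y t₀)
    (hA : x t₀ ^ 2 + y t₀ ^ 2 + x t₀ * y t₀ * φ (x t₀, y t₀) ≤ 0) : False := by
  obtain ⟨R₁, hR₁, hxR⟩ := aux_periodic_bdd hT px
    (continuous_iff_continuousAt.2 fun t => (hx t).continuousAt)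
  obtain ⟨R₂, hR₂, hyR⟩ := aux_periodic_bdd hT py
    (continuous_iff_continuousAt.2 fun t => (hy t).continuousAt)
  obtain ⟨m, hmq⟩ : ∃ m, m = y t₀ / (- x t₀) := ⟨_, rfl⟩
  have hx0n : 0 < - x t₀ := by linarith
  have hmp : 0 < m := by rw [hmq]; positivity
  have hxne : x t₀ ≠ 0 := hx0.ne
  have hyq : y t₀ = - m * x t₀ := by rw [hmq]; field_simp
  obtain ⟨q, hq⟩ : ∃ q, q = x t₀ := ⟨_, rfl⟩
  have hqR : |q| ≤ R₁ := hq ▸ hxR t₀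
  rw [hyq, ← hq] at hA
  rw [← hq] at hx0 hyq
  obtain ⟨K, hK0, hKb, hKl⟩ := aux_lip hφ (R₁ + R₂ + m * R₁)
  have hmR : 0 < m * R₁ := by positivity
  have hPq : 1 + m ^ 2 - m * φ (q, - m * q) ≤ 0 := by
    have : q ^ 2 * (1 + m ^ 2 - m * φ (q, - m * q)) ≤ 0 := by nlinarith
    by_contra hc
    push Not at hc
    have : 0 < q ^ 2 * (1 + m ^ 2 - m * φ (q, - m * q)) := mul_pos (by nlinarith) hc
    linarith
  have hP0 : ∀ ξ, ξ ≤ q → 1 + m ^ 2 - m * φ (ξ, - m * ξ) ≤ 0 := by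
    intro ξ h2
    have hξ : ξ < 0 := by linarith
    have hξne : ξ ≠ 0 := hξ.ne
    have h3 : q / ξ ≤ 1 := by rw [div_le_one_of_neg hξ]; exact h2
    have := hm ξ (- m * ξ) (q / ξ) (div_nonneg_of_nonpos hx0.le hξ.le) h3
    have e1 : q / ξ * ξ = q := by field_simp
    have e2 : q / ξ * (- m * ξ) = - m * q := by field_simp
    rw [e1, e2] at this
    nlinarith
  obtain ⟨B, hB⟩ : ∃ B, B = 1 + m ^ 2 + m * K := ⟨_, rfl⟩
  have hB0 : 0 < B := by rw [hB]; positivity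
  obtain ⟨G, hG⟩ : ∃ G, G = R₁ * (m * K * (1 + m)) + B := ⟨_, rfl⟩
  have hG1 : 0 ≤ R₁ * (m * K * (1 + m)) := by positivity
  have key : ∀ t ≤ t₀, (max (-(y t + m * x t)) 0) ^ 2 + (max (x t - q) 0) ^ 2 = 0 := by
    refine aux_gronwall (2 * (G * 2 + K + 1 + m)) t₀
      (W' := fun t => 2 * max (-(y t + m * x t)) 0 * (-((- x t - y t * φ (x t, y t)) + m * y t))
        + 2 * max (x t - q) 0 * (y t)) ?_ ?_ ?_ ?_
    · intro t
      exact ((aux_sqmax_comp ((hy t).add ((hx t).const_mul m)).neg).add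
        (aux_sqmax_comp ((hx t).sub_const q)))
    · intro t
      have hKt := hKb (x t) (y t) (by linarith [hxR t]) (by linarith [hyR t])
      have hxt := hxR t
      have hLt := fun c => hKl (x t) (y t) c (- m * c) (by linarith [hxR t]) (by linarith [hyR t])
      generalize x t = X at *
      generalize y t = Y at *
      obtain ⟨f, hf⟩ : ∃ f, f = φ (X, Y) := ⟨_, rfl⟩
      rw [← hf] at hKt hLt ⊢
      obtain ⟨D, hD⟩ : ∃ D, D = max (-(Y + m * X)) 0 := ⟨_, rfl⟩
      obtain ⟨E, hE⟩ : ∃ E, E = max (X - q) 0 := ⟨_, rfl⟩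
      rw [← hD, ← hE]
      have hD0 : 0 ≤ D := hD ▸ le_max_right _ _
      have hE0 : 0 ≤ E := hE ▸ le_max_right _ _
      have hD1 : -(Y + m * X) ≤ D := hD ▸ le_max_left _ _
      have hE1 : X - q ≤ E := hE ▸ le_max_left _ _
      have hDu : D * (Y + m * X) = - D ^ 2 := by
        rcases le_total (-(Y + m * X)) 0 with h | h
        · rw [hD, max_eq_right h]; ring
        · rw [hD, max_eq_left h]; ring
      have hfa := abs_le.1 hKt
      have hE2 : - (E * Y) ≤ E * D + m * E ^ 2 := by
        have h0 : X ≤ E := by linarith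
        have h1 : - Y ≤ D + m * E := by linarith [mul_le_mul_of_nonneg_left h0 hmp.le]
        linarith [mul_le_mul_of_nonneg_left h1 hE0]
      have hXP : D * (- X * (1 + m ^ 2 - m * f)) ≤ D * (G * (D + E)) := by
        rcases hD0.eq_or_lt with h0 | hDpos
        · rw [← h0]; simp
        have hDeq : Y + m * X = - D := by
          have : D * (Y + m * X + D) = 0 := by linear_combination hDu
          rcases mul_eq_zero.1 this with h | h <;> linarith
        apply mul_le_mul_of_nonneg_left _ hD0
        rcases le_total X 0 with hX | hX
        · have hR1X : - X ≤ R₁ := (neg_le_abs X).trans hxt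
          have hξ : X - min X q = E := by
            rcases le_total X q with h | h
            · rw [min_eq_left h, hE, max_eq_right (by linarith)]; ring
            · rw [min_eq_right h, hE, max_eq_left (by linarith)]
          have hξ1 : min X q ≤ q := min_le_right _ _
          have hξ2 : |min X q| ≤ R₁ := by
            rcases le_total X q with h | h
            · rwa [min_eq_left h]
            · rwa [min_eq_right h]
          generalize min X q = ξ at *
          have hl := hLt ξ (by linarith)
            (by rw [abs_mul, abs_neg, abs_of_pos hmp]; linarith [mul_le_mul_of_nonneg_left hξ2 hmp.le])
          have hp := hP0 ξ hξ1
          have e1 : |X - ξ| = E := by rw [hξ, abs_of_nonneg hE0]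
          have e2 : |Y - - m * ξ| ≤ D + m * E := by
            have : Y - - m * ξ = - D - m * E := by linear_combination hDeq - m * hξ
            rw [this]
            have : 0 ≤ m * E := by positivity
            rw [abs_le]; constructor <;> linarith
          have h1 : φ (ξ, - m * ξ) - f ≤ K * (E + (D + m * E)) := by
            rw [abs_sub_comm] at hl
            refine (le_abs_self _).trans (hl.trans ?_)
            rw [e1]
            exact mul_le_mul_of_nonneg_left (by linarith) hK0
          have h2 : 1 + m ^ 2 - m * f ≤ m * (K * (E + (D + m * E))) := by
            linarith [mul_le_mul_of_nonneg_left h1 hmp.le]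
          have h3 : m * (K * (E + (D + m * E))) ≤ m * K * (1 + m) * (D + E) := by
            have : 0 ≤ m * K := by positivity
            have h4 : E + (D + m * E) ≤ (1 + m) * (D + E) := by
              linarith [mul_nonneg hmp.le hD0]
            calc m * (K * (E + (D + m * E))) = m * K * (E + (D + m * E)) := by ring
              _ ≤ m * K * ((1 + m) * (D + E)) := mul_le_mul_of_nonneg_left h4 this
              _ = _ := by ring
          have h5 : 0 ≤ m * K * (1 + m) * (D + E) := by positivity
          calc -X * (1 + m ^ 2 - m * f) ≤ -X * (m * K * (1 + m) * (D + E)) :=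
                mul_le_mul_of_nonneg_left (h2.trans h3) (by linarith)
            _ ≤ R₁ * (m * K * (1 + m) * (D + E)) := mul_le_mul_of_nonneg_right hR1X h5
            _ ≤ G * (D + E) := by
                rw [hG]
                have : 0 ≤ B * (D + E) := by positivity
                linarith
        · have h1 : -(1 + m ^ 2 - m * f) ≤ B := by
            rw [hB]
            linarith [mul_le_mul_of_nonneg_left hfa.1 hmp.le, mul_le_mul_of_nonneg_left hfa.2 hmp.le, sq_nonneg m]
          calc -X * (1 + m ^ 2 - m * f) = X * (-(1 + m ^ 2 - m * f)) := by ring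
            _ ≤ X * B := mul_le_mul_of_nonneg_left h1 (by linarith)
            _ ≤ E * B := mul_le_mul_of_nonneg_right (by linarith) hB0.le
            _ ≤ G * (D + E) := by
                rw [hG]
                have h2 : 0 ≤ R₁ * (m * K * (1 + m)) * (D + E) := by positivity
                have h3 : 0 ≤ B * D := by positivity
                linarith
      have hDm : D * ((- X - Y * f) + m * Y) ≤ D * (G * (D + E)) + K * D ^ 2 := by
        have h1 : D * ((- X - Y * f) + m * Y) =
            D * (- X * (1 + m ^ 2 - m * f)) + (f - m) * D ^ 2 := by
          linear_combination (m - f) * hDu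
        have h2 : (f - m) * D ^ 2 ≤ K * D ^ 2 :=
          mul_le_mul_of_nonneg_right (by linarith) (sq_nonneg _)
        linarith
      have hGn : 0 ≤ G := by rw [hG]; linarith
      have s1 : D * (G * (D + E)) ≤ G * 2 * (D ^ 2 + E ^ 2) := by
        have : D * (D + E) ≤ 2 * (D ^ 2 + E ^ 2) := by
          nlinarith [sq_nonneg (D - E), sq_nonneg E, sq_nonneg D]
        linarith [mul_le_mul_of_nonneg_left this hGn]
      have s2 : E * D ≤ 1 * (D ^ 2 + E ^ 2) := by
        nlinarith [sq_nonneg (E - D), sq_nonneg D, sq_nonneg E]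
      have s4 : m * E ^ 2 ≤ m * (D ^ 2 + E ^ 2) :=
        mul_le_mul_of_nonneg_left (by nlinarith [sq_nonneg D]) (by linarith)
      have s5 : K * D ^ 2 ≤ K * (D ^ 2 + E ^ 2) :=
        mul_le_mul_of_nonneg_left (by nlinarith [sq_nonneg E]) (by linarith)
      linarith only [s1, s2, s4, s5, hDm, hE2]
    · intro t; positivity
    · rw [hyq, ← hq]
      simp
  refine aux_contra hT hx px py (t₀ := t₀) (fun t ht => ?_) hy0
  have h := key t ht
  have i1 := sq_nonneg (max (-(y t + m * x t)) 0)
  have i2 := sq_nonneg (max (x t - q) 0)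
  have h3 : (max (-(y t + m * x t)) 0) ^ 2 = 0 := by linarith
  have h3' : (max (x t - q) 0) ^ 2 = 0 := by linarith
  have h4 : max (-(y t + m * x t)) 0 = 0 := by simpa using h3
  have h4' : max (x t - q) 0 = 0 := by simpa using h3'
  have := le_max_left (-(y t + m * x t)) 0
  have := le_max_left (x t - q) 0
  nlinarith

lemma aux_nozero {f f' : ℝ → ℝ} {T : ℝ} (hT : 0 < T) (hf : ∀ t, HasDerivAt f (f' t) t)
    (hp : Function.Periodic f T) (h : ∀ t, f t = 0 → f' t < 0) : ∀ t, f t ≠ 0 := by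
  intro t₀ h0
  have hle : ∀ t, t₀ ≤ t → f t ≤ 0 := by
    intro t ht
    exact image_le_of_deriv_right_lt_deriv_boundary (f := f) (f' := f') (a := t₀) (b := t)
      (B := fun _ => 0) (B' := fun _ => 0)
      (fun s _ => (hf s).continuousAt.continuousWithinAt)
      (fun s _ => (hf s).hasDerivWithinAt) h0.le (fun s => hasDerivAt_const s 0)
      (fun s _ hs => h s hs) ⟨ht, le_rfl⟩
  have hmax : IsLocalMax f t₀ := by
    filter_upwards [Ici_mem_nhds (show t₀ - T < t₀ by linarith)] with t ht
    rw [h0, ← hp t]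
    exact hle _ (by linarith [mem_Ici.1 ht])
  have := hmax.hasDerivAt_eq_zero (hf t₀)
  linarith [h t₀ h0]

lemma aux_log {z z' : ℝ → ℂ} (hz : ∀ t, HasDerivAt z (z' t) t) (hc : Continuous z')
    (hne : ∀ t, z t ≠ 0) : (∀ t, HasDerivAt (fun t => ∫ s in (0:ℝ)..t, z' s / z s) (z' t / z t) t) ∧
    ∀ t, z t = z 0 * Complex.exp (∫ s in (0:ℝ)..t, z' s / z s) := by
  have hzc : Continuous z := continuous_iff_continuousAt.2 fun t => (hz t).continuousAt
  have hcont : Continuous (fun s => z' s / z s) := hc.div hzc hne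
  have hg : ∀ t, HasDerivAt (fun t => ∫ s in (0:ℝ)..t, z' s / z s) (z' t / z t) t := fun t =>
    (hcont.integral_hasStrictDerivAt 0 t).hasDerivAt
  refine ⟨hg, fun t => ?_⟩
  have hF : ∀ t, HasDerivAt (fun t => z t * Complex.exp (-(∫ s in (0:ℝ)..t, z' s / z s))) 0 t := by
    intro t
    have := (hz t).mul ((hg t).neg.cexp)
    refine this.congr_deriv ?_
    have h3 := hne t
    rw [mul_comm (Complex.exp _), ← mul_assoc, mul_neg, mul_div_cancel₀ _ h3]
    ring
  have hconst := is_const_of_deriv_eq_zero (fun t => (hF t).differentiableAt)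
    (fun t => (hF t).deriv) t 0
  simp only [intervalIntegral.integral_same, neg_zero, Complex.exp_zero, mul_one] at hconst
  rw [← hconst, mul_assoc, ← Complex.exp_add]
  simp

lemma aux_hz {x y : ℝ → ℝ} {x' y' t : ℝ} (hx : HasDerivAt x x' t) (hy : HasDerivAt y y' t) :
    HasDerivAt (fun s => (⟨x s, y s⟩ : ℂ)) ⟨x', y'⟩ t := by
  have h1 := (hx.ofReal_comp).add ((hy.ofReal_comp).mul_const Complex.I)
  have e1 : (fun s => (⟨x s, y s⟩ : ℂ)) =
      (fun y => ((x y : ℝ) : ℂ)) + fun s => ((y s : ℝ) : ℂ) * Complex.I := by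
    funext s; simp [Complex.ext_iff]
  rw [e1]
  refine h1.congr_deriv ?_
  simp [Complex.ext_iff]

lemma aux_ne_origin {φ : ℝ × ℝ → ℝ} (hφ : ContDiff ℝ 1 φ)
    {x y : ℝ → ℝ} {T : ℝ} (hT : 0 < T)
    (hx : ∀ t, HasDerivAt x (y t) t)
    (hy : ∀ t, HasDerivAt y (- x t - y t * φ (x t, y t)) t)
    (px : Function.Periodic x T) (py : Function.Periodic y T)
    (hnc : ∃ t, x t ≠ 0 ∨ y t ≠ 0) (t₀ : ℝ) (hx0 : x t₀ = 0) (hy0 : y t₀ = 0) : False := by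
  obtain ⟨R₁, hR₁, hxR⟩ := aux_periodic_bdd hT px
    (continuous_iff_continuousAt.2 fun t => (hx t).continuousAt)
  obtain ⟨R₂, hR₂, hyR⟩ := aux_periodic_bdd hT py
    (continuous_iff_continuousAt.2 fun t => (hy t).continuousAt)
  obtain ⟨K, hK0, hKb, -⟩ := aux_lip hφ (R₁ + R₂)
  have key : ∀ t ≤ t₀, x t ^ 2 + y t ^ 2 = 0 := by
    refine aux_gronwall (2 * K) t₀ (W' := fun t => 2 * x t * y t
      + 2 * y t * (- x t - y t * φ (x t, y t))) ?_ ?_ ?_ ?_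
    · intro t
      have := ((hx t).pow 2).add ((hy t).pow 2)
      refine (this.congr_deriv ?_)
      simp
    · intro t
      have := (abs_le.1 (hKb (x t) (y t) (by linarith [hxR t]) (by linarith [hyR t]))).2
      have h1 := mul_le_mul_of_nonneg_left this (sq_nonneg (y t))
      have h2 := mul_nonneg hK0 (sq_nonneg (x t))
      linarith
    · intro t; positivity
    · simp [hx0, hy0]
  obtain ⟨t, ht⟩ := hnc
  obtain ⟨n, hn⟩ := exists_nat_ge ((t - t₀) / T)
  have h1 := key (t - n • T) (by
    rw [div_le_iff₀ hT] at hn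
    rw [nsmul_eq_mul]; linarith)
  rw [px.sub_nsmul_eq n, py.sub_nsmul_eq n] at h1
  have h2 : x t = 0 := by nlinarith [sq_nonneg (x t), sq_nonneg (y t)]
  have h3 : y t = 0 := by nlinarith [sq_nonneg (x t), sq_nonneg (y t)]
  tauto

lemma aux_winding {φ : ℝ × ℝ → ℝ} (hφ : ContDiff ℝ 1 φ)
    {x y : ℝ → ℝ} {T : ℝ} (hT : 0 < T)
    (hx : ∀ t, HasDerivAt x (y t) t)
    (hy : ∀ t, HasDerivAt y (- x t - y t * φ (x t, y t)) t)
    (px : Function.Periodic x T) (py : Function.Periodic y T)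
    (hno : ∀ t, ¬ (x t = 0 ∧ y t = 0)) :
    (∫ s in (0:ℝ)..T, ((⟨y s, - x s - y s * φ (x s, y s)⟩ : ℂ) / (⟨x s, y s⟩ : ℂ))) ≠ 0 := by
  intro h0
  obtain ⟨z, hzd⟩ : ∃ z : ℝ → ℂ, z = fun s => ⟨x s, y s⟩ := ⟨_, rfl⟩
  obtain ⟨z', hzd'⟩ : ∃ z' : ℝ → ℂ, z' = fun s => ⟨y s, - x s - y s * φ (x s, y s)⟩ := ⟨_, rfl⟩
  have h0' : ∫ s in (0:ℝ)..T, z' s / z s = 0 := by rw [hzd, hzd']; exact h0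
  have cx : Continuous x := continuous_iff_continuousAt.2 fun t => (hx t).continuousAt
  have cy : Continuous y := continuous_iff_continuousAt.2 fun t => (hy t).continuousAt
  have hz : ∀ t, HasDerivAt z (z' t) t := by
    intro t
    rw [hzd, hzd']
    exact aux_hz (hx t) (hy t)
  have hc : Continuous z' := by
    have cφ : Continuous fun s => φ (x s, y s) := hφ.continuous.comp (cx.prodMk cy)
    have : z' = fun s => ((y s : ℝ) : ℂ) + ((- x s - y s * φ (x s, y s) : ℝ) : ℂ) * Complex.I := by
      rw [hzd']; funext s; simp [Complex.ext_iff]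
    rw [this]
    fun_prop
  have hne : ∀ t, z t ≠ 0 := by
    intro t h
    rw [hzd] at h
    exact hno t (by simpa [Complex.ext_iff] using h)
  obtain ⟨hg, hlog⟩ := aux_log hz hc hne
  have hcz : Continuous z := continuous_iff_continuousAt.2 fun t => (hz t).continuousAt
  have hcont : Continuous (fun s => z' s / z s) := hc.div hcz hne
  have hper : Function.Periodic (fun s => z' s / z s) T := by
    intro s
    simp only [hzd, hzd', px s, py s]
  have hgp : Function.Periodic (fun t => ∫ s in (0:ℝ)..t, z' s / z s) T := by
    intro t
    have h1 := intervalIntegral.integral_add_adjacent_intervals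
      (hcont.intervalIntegrable (μ := MeasureTheory.volume) 0 t) (hcont.intervalIntegrable t (t + T))
    have h2 := hper.intervalIntegral_add_eq t 0
    rw [zero_add, h0'] at h2
    rw [h2, add_zero] at h1
    exact h1.symm
  obtain ⟨g, hgd⟩ : ∃ g : ℝ → ℂ, g = fun t => ∫ s in (0:ℝ)..t, z' s / z s := ⟨_, rfl⟩
  have hlog' : ∀ t, z t = z 0 * Complex.exp (g t) := by rw [hgd]; exact hlog
  rw [← hgd] at hg hgp
  obtain ⟨c, -, hc0⟩ := exists_hasDerivAt_eq_zero (f := x) (f' := y) hT cx.continuousOn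
    (by simpa using (px 0).symm) (fun t _ => hx t)
  have hrel : ∀ t, z t = z c * Complex.exp (g t - g c) := by
    intro t
    rw [hlog' t, hlog' c, mul_assoc, ← Complex.exp_add]
    congr 2; ring
  have hf : ∀ t, HasDerivAt (fun t => (g t - g c).im) ((z' t / z t).im) t := by
    intro t
    exact Complex.imCLM.hasFDerivAt.comp_hasDerivAt t ((hg t).sub_const (g c))
  refine aux_nozero hT hf (fun t => by simp only [hgp t]) ?_ c (by simp)
  intro t ht
  have hyt : y t = 0 := by
    have h1 : (z t).im = 0 := by
      rw [hrel t, Complex.mul_im, Complex.exp_im, ht]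
      have : (z c).im = 0 := by rw [hzd]; exact hc0
      rw [this]; simp
    rw [hzd] at h1; exact h1
  have hxt : x t ≠ 0 := fun h => hno t ⟨h, hyt⟩
  have : (z' t / z t).im = -1 := by
    rw [hzd, hzd', Complex.div_im]
    simp only [hyt, Complex.normSq_mk]
    field_simp
    ring
  rw [this]; norm_num

lemma aux_inner {φ : ℝ × ℝ → ℝ} (hφ : ContDiff ℝ 1 φ)
    {x y : ℝ → ℝ} {T : ℝ} (hT : 0 < T)
    (hx : ∀ t, HasDerivAt x (y t) t)
    (hy : ∀ t, HasDerivAt y (- x t - y t * φ (x t, y t)) t)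
    (px : Function.Periodic x T) (py : Function.Periodic y T)
    (hno : ∀ t, ¬ (x t = 0 ∧ y t = 0)) :
    (0 : ℝ × ℝ) ∈ innerRegion (range fun t => (x t, y t)) := by
  have h0mem : (0 : ℝ × ℝ) ∉ range fun t => (x t, y t) := by
    rintro ⟨t, ht⟩
    exact hno t (by simpa [Prod.ext_iff] using ht)
  refine ⟨h0mem, ?_⟩
  by_contra hunb
  obtain ⟨Γ, hΓ⟩ : ∃ Γ, Γ = range fun t => (x t, y t) := ⟨_, rfl⟩
  rw [← hΓ] at hunb h0mem
  obtain ⟨z, hzd⟩ : ∃ z : ℝ → ℂ, z = fun s => ⟨x s, y s⟩ := ⟨_, rfl⟩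
  obtain ⟨z', hzd'⟩ : ∃ z' : ℝ → ℂ, z' = fun s => ⟨y s, - x s - y s * φ (x s, y s)⟩ := ⟨_, rfl⟩
  have cx : Continuous x := continuous_iff_continuousAt.2 fun t => (hx t).continuousAt
  have cy : Continuous y := continuous_iff_continuousAt.2 fun t => (hy t).continuousAt
  have hz : ∀ t, HasDerivAt z (z' t) t := by
    intro t
    rw [hzd, hzd']
    exact aux_hz (hx t) (hy t)
  have hc : Continuous z' := by
    have cφ : Continuous fun s => φ (x s, y s) := hφ.continuous.comp (cx.prodMk cy)
    have : z' = fun s => ((y s : ℝ) : ℂ) + ((- x s - y s * φ (x s, y s) : ℝ) : ℂ) * Complex.I := by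
      rw [hzd']; funext s; simp [Complex.ext_iff]
    rw [this]
    fun_prop
  have hcz : Continuous z := continuous_iff_continuousAt.2 fun t => (hz t).continuousAt
  have pz : Function.Periodic z T := fun t => by simp only [hzd, px t, py t]
  have pz' : Function.Periodic z' T := fun t => by simp only [hzd', px t, py t]
  obtain ⟨e, he⟩ : ∃ e : ℝ × ℝ → ℂ, e = fun q => (q.1 : ℂ) + (q.2 : ℂ) * Complex.I := ⟨_, rfl⟩
  have hec : Continuous e := by rw [he]; fun_prop
  have hzne : ∀ q ∈ Γᶜ, ∀ t, z t - e q ≠ 0 := by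
    intro q hq t h
    apply hq
    rw [hΓ]
    refine ⟨t, ?_⟩
    rw [sub_eq_zero, hzd, he] at h
    simpa [Complex.ext_iff, Prod.ext_iff] using h
  obtain ⟨W, hW⟩ : ∃ W : ℝ × ℝ → ℂ, W = fun q => ∫ s in (0:ℝ)..T, z' s / (z s - e q) := ⟨_, rfl⟩
  have hWc : ContinuousOn W Γᶜ := by
    rw [continuousOn_iff_continuous_domRestrict, hW]
    refine intervalIntegral.continuous_parametric_intervalIntegral_of_continuous'
      (f := fun (q : ↥(Γᶜ)) s => z' s / (z s - e q)) ?_ 0 T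
    refine Continuous.div (hc.comp continuous_snd) ?_ ?_
    · exact (hcz.comp continuous_snd).sub (hec.comp (continuous_subtype_val.comp continuous_fst))
    · rintro ⟨q, s⟩
      exact hzne q q.2 s
  have hWint : ∀ q ∈ Γᶜ, ∃ n : ℤ, W q = n * (2 * Real.pi * Complex.I) := by
    intro q hq
    rw [← Complex.exp_eq_one_iff]
    have h1 := (aux_log (z := fun t => z t - e q) (fun t => (hz t).sub_const (e q)) hc (hzne q hq)).2 T
    have h2 : z T = z 0 := by simpa using pz 0
    simp only [h2] at h1
    have h3 := hzne q hq 0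
    rw [hW]
    have : (z 0 - e q) * (Complex.exp (∫ s in (0:ℝ)..T, z' s / (z s - e q)) - 1) = 0 := by
      rw [mul_sub, ← h1]; ring
    rcases mul_eq_zero.1 this with h | h
    · exact absurd h h3
    · exact sub_eq_zero.1 h
  have hW0 : W 0 ≠ 0 := by
    have := aux_winding hφ hT hx hy px py hno
    rw [hW, hzd, hzd', he]
    simpa using this
  have hpi := Real.pi_gt_three
  have hnorm : ∀ n : ℤ, ‖(n : ℂ) * (2 * Real.pi * Complex.I)‖ = |(n : ℝ)| * (2 * Real.pi) := by
    intro n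
    simp [abs_of_pos Real.pi_pos]
  have hW0n : 1 ≤ ‖W 0‖ := by
    obtain ⟨n, hn⟩ := hWint 0 h0mem
    rw [hn, hnorm]
    have : n ≠ 0 := by rintro rfl; apply hW0; rw [hn]; simp
    have h1 : (1 : ℝ) ≤ |(n : ℝ)| := by exact_mod_cast Int.one_le_abs this
    nlinarith
  -- far point
  obtain ⟨R, hR0, hR⟩ := (pz.compact_of_continuous hT.ne' hcz).isBounded.exists_pos_norm_le
  obtain ⟨M, hM0, hM⟩ := (pz'.compact_of_continuous hT.ne' hc).isBounded.exists_pos_norm_le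
  obtain ⟨q, hqC, hq⟩ : ∃ q ∈ connectedComponentIn Γᶜ (0 : ℝ × ℝ), R + (M * T + 1) < ‖q‖ := by
    by_contra hcon
    push Not at hcon
    exact hunb (isBounded_iff_forall_norm_le.2 ⟨_, hcon⟩)
  have hsub := connectedComponentIn_subset Γᶜ (0 : ℝ × ℝ)
  have heq : ‖q‖ ≤ ‖e q‖ := by
    rw [Prod.norm_def, he]
    refine max_le ?_ ?_
    · have := Complex.abs_re_le_norm ((q.1 : ℂ) + (q.2 : ℂ) * Complex.I)
      simpa using this
    · have := Complex.abs_im_le_norm ((q.1 : ℂ) + (q.2 : ℂ) * Complex.I)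
      simpa using this
  have hMT : 0 < M * T := by positivity
  have hWq : ‖W q‖ < 1 := by
    have h1 : ‖W q‖ ≤ M / (M * T + 1) * |T - 0| := by
      rw [hW]
      refine intervalIntegral.norm_integral_le_of_norm_le_const fun s _ => ?_
      rw [norm_div]
      have h2 := hR _ (mem_range_self s)
      have h3 := hM _ (mem_range_self s)
      have h4 : M * T + 1 ≤ ‖z s - e q‖ := by
        have := norm_sub_norm_le (e q) (z s)
        rw [norm_sub_rev] at this
        linarith
      gcongr
    refine h1.trans_lt ?_
    rw [sub_zero, abs_of_pos hT, div_mul_eq_mul_div, div_lt_one (by positivity)]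
    linarith
  obtain ⟨w, hwC, hw⟩ := isPreconnected_connectedComponentIn.intermediate_value hqC
    (mem_connectedComponentIn h0mem) ((hWc.mono hsub).norm) ⟨hWq.le, hW0n⟩
  obtain ⟨n, hn⟩ := hWint w (hsub hwC)
  simp only at hw
  rw [hn, hnorm] at hw
  rcases eq_or_ne n 0 with h | h
  · rw [h] at hw; simp at hw
  · have h1 : (1 : ℝ) ≤ |(n : ℝ)| := by exact_mod_cast Int.one_le_abs h
    nlinarith

lemma aux_pos {φ : ℝ × ℝ → ℝ} (hφ : ContDiff ℝ 1 φ)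
    (hm : ∀ a b s : ℝ, 0 ≤ s → s ≤ 1 → φ (s * a, s * b) ≤ φ (a, b))
    {x y : ℝ → ℝ} {T : ℝ} (hT : 0 < T)
    (hx : ∀ t, HasDerivAt x (y t) t)
    (hy : ∀ t, HasDerivAt y (- x t - y t * φ (x t, y t)) t)
    (px : Function.Periodic x T) (py : Function.Periodic y T)
    (hno : ∀ t, ¬ (x t = 0 ∧ y t = 0)) (t : ℝ) :
    0 < x t ^ 2 + y t ^ 2 + x t * y t * φ (x t, y t) := by
  by_contra hA
  push Not at hA
  have hφ' : ContDiff ℝ 1 (fun p : ℝ × ℝ => φ (-p)) := hφ.comp contDiff_neg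
  have hm' : ∀ a b s : ℝ, 0 ≤ s → s ≤ 1 →
      (fun p : ℝ × ℝ => φ (-p)) (s * a, s * b) ≤ (fun p : ℝ × ℝ => φ (-p)) (a, b) := by
    intro a b s h0 h1
    have := hm (-a) (-b) s h0 h1
    simpa using this
  have hx' : ∀ t, HasDerivAt (fun t => - x t) ((fun t => - y t) t) t := fun t => (hx t).neg
  have hy' : ∀ t, HasDerivAt (fun t => - y t) (- (fun t => - x t) t - (fun t => - y t) t *
      (fun p : ℝ × ℝ => φ (-p)) ((fun t => - x t) t, (fun t => - y t) t)) t := fun t =>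
    (hy t).neg.congr_deriv (by simp; ring)
  have px' : Function.Periodic (fun t => - x t) T := fun t => by simp only [px t]
  have py' : Function.Periodic (fun t => - y t) T := fun t => by simp only [py t]
  have hA' : (fun t => - x t) t ^ 2 + (fun t => - y t) t ^ 2 + (fun t => - x t) t * (fun t => - y t) t *
      (fun p : ℝ × ℝ => φ (-p)) ((fun t => - x t) t, (fun t => - y t) t) ≤ 0 := by
    simpa using hA
  rcases lt_trichotomy (x t) 0 with h1 | h1 | h1 <;> rcases lt_trichotomy (y t) 0 with h2 | h2 | h2
  · exact aux_Q1 hφ' hm' hT hx' hy' px' py' (by simpa using h1) (by simpa using h2) hA'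
  · rw [h2] at hA; nlinarith
  · exact aux_Q2 hφ hm hT hx hy px py h1 h2 hA
  · rw [h1] at hA; nlinarith
  · exact hno t ⟨h1, h2⟩
  · rw [h1] at hA; nlinarith
  · exact aux_Q2 hφ' hm' hT hx' hy' px' py' (by simpa using h1) (by simpa using h2) hA'
  · rw [h2] at hA; nlinarith
  · exact aux_Q1 hφ hm hT hx hy px py h1 h2 hA

lemma aux_cycle {φ : ℝ × ℝ → ℝ} (hφ : ContDiff ℝ 1 φ)
    (hm : ∀ a b s : ℝ, 0 ≤ s → s ≤ 1 → φ (s * a, s * b) ≤ φ (a, b))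
    {γ : ℝ → ℝ × ℝ} {T : ℝ} (h : IsCycle (phiVF φ) γ T) :
    (∀ p ∈ range γ, 0 < p.1 ^ 2 + p.2 ^ 2 + p.1 * p.2 * φ p) ∧
    (0 : ℝ × ℝ) ∈ innerRegion (range γ) := by
  obtain ⟨hd, hT, hp, t₁, t₂, hne⟩ := h
  have hx : ∀ t, HasDerivAt (fun t => (γ t).1) ((fun t => (γ t).2) t) t := fun t =>
    (ContinuousLinearMap.fst ℝ ℝ ℝ).hasFDerivAt.comp_hasDerivAt t (hd t)
  have hy : ∀ t, HasDerivAt (fun t => (γ t).2) (- (fun t => (γ t).1) t - (fun t => (γ t).2) t *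
      φ ((fun t => (γ t).1) t, (fun t => (γ t).2) t)) t := fun t =>
    (ContinuousLinearMap.snd ℝ ℝ ℝ).hasFDerivAt.comp_hasDerivAt t (hd t)
  have px : Function.Periodic (fun t => (γ t).1) T := fun t => by simp only [hp t]
  have py : Function.Periodic (fun t => (γ t).2) T := fun t => by simp only [hp t]
  have hnc : ∃ t, (fun t => (γ t).1) t ≠ 0 ∨ (fun t => (γ t).2) t ≠ 0 := by
    by_contra hcon
    push Not at hcon
    apply hne
    have h1 := hcon t₁
    have h2 := hcon t₂
    exact Prod.ext (h1.1.trans h2.1.symm) (h1.2.trans h2.2.symm)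
  have hno : ∀ t, ¬ ((fun t => (γ t).1) t = 0 ∧ (fun t => (γ t).2) t = 0) := fun t ht =>
    aux_ne_origin hφ hT hx hy px py hnc t ht.1 ht.2
  constructor
  · rintro _ ⟨t, rfl⟩
    exact aux_pos hφ hm hT hx hy px py hno t
  · exact aux_inner hφ hT hx hy px py hno

/-- if the star-shapedness inequality `x φ_x + y φ_y ≥ 0` holds
everywhere and the system (S) has two distinct limit cycles `μ₁` (inner) and
`μ₂` (outer), then `A(x,y) = x² + y² + x y φ(x,y) > 0` on the closed annular
region `D₁₂` bounded by the two orbits. -/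
theorem statement0 (φ : ℝ × ℝ → ℝ) (hφ : ContDiff ℝ 1 φ)
    (hstar : ∀ p : ℝ × ℝ,
      p.1 * fderiv ℝ φ p (1, 0) + p.2 * fderiv ℝ φ p (0, 1) ≥ 0)
    (μ₁ μ₂ : ℝ → ℝ × ℝ) (T₁ T₂ : ℝ)
    (h₁ : IsLimitCycle (phiVF φ) μ₁ T₁)
    (h₂ : IsLimitCycle (phiVF φ) μ₂ T₂)
    (hdist : range μ₁ ≠ range μ₂)
    (hinner : range μ₁ ⊆ innerRegion (range μ₂)) :
    ∀ p ∈ (innerRegion (range μ₂) ∪ range μ₂) \ innerRegion (range μ₁),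
      p.1 ^ 2 + p.2 ^ 2 + p.1 * p.2 * φ p > 0 := by
  intro p hp
  by_contra hA
  push Not at hA
  have hm := aux_mono hφ hstar
  obtain ⟨hpos1, h01⟩ := aux_cycle hφ hm h₁.1
  obtain ⟨hpos2, -⟩ := aux_cycle hφ hm h₂.1
  rcases le_or_gt 0 (p.1 * p.2) with hxy | hxy
  · apply hp.2
    have hcont : Continuous (fun s : ℝ => s • p) := by fun_prop
    have hpre : IsPreconnected ((fun s : ℝ => s • p) '' Icc 0 1) :=
      isPreconnected_Icc.image _ hcont.continuousOn
    have hsub : ((fun s : ℝ => s • p) '' Icc 0 1) ⊆ (range μ₁)ᶜ := by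
      rintro _ ⟨s, hs, rfl⟩ hmem
      have h1 := hpos1 _ hmem
      have h2 := hm p.1 p.2 s hs.1 hs.2
      have e : s • p = (s * p.1, s * p.2) := rfl
      simp only [e] at h1
      have h3 := mul_le_mul_of_nonneg_left h2 hxy
      have h4 : s ^ 2 * (p.1 ^ 2 + p.2 ^ 2 + p.1 * p.2 * φ (s * p.1, s * p.2)) ≤ 0 :=
        mul_nonpos_of_nonneg_of_nonpos (sq_nonneg s) (by linarith)
      linarith
    have hmp : p ∈ ((fun s : ℝ => s • p) '' Icc 0 1) := ⟨1, ⟨zero_le_one, le_rfl⟩, one_smul _ _⟩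
    have hm0 : (0 : ℝ × ℝ) ∈ ((fun s : ℝ => s • p) '' Icc 0 1) :=
      ⟨0, ⟨le_rfl, zero_le_one⟩, zero_smul _ _⟩
    refine ⟨hsub hmp, ?_⟩
    rw [← connectedComponentIn_eq (hpre.subset_connectedComponentIn hm0 hsub hmp)]
    exact h01.2
  · have hcont : Continuous (fun s : ℝ => s • p) := by fun_prop
    have hpre : IsPreconnected ((fun s : ℝ => s • p) '' Ici 1) :=
      isPreconnected_Ici.image _ hcont.continuousOn
    have hsub : ((fun s : ℝ => s • p) '' Ici 1) ⊆ (range μ₂)ᶜ := by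
      rintro _ ⟨s, hs, rfl⟩ hmem
      have hs1 : (1 : ℝ) ≤ s := hs
      have h1 := hpos2 _ hmem
      have hs0 : 0 < s := by linarith
      have h2 := hm (s * p.1) (s * p.2) s⁻¹ (by positivity) (inv_le_one_of_one_le₀ hs1)
      rw [inv_mul_cancel_left₀ hs0.ne', inv_mul_cancel_left₀ hs0.ne'] at h2
      have e : s • p = (s * p.1, s * p.2) := rfl
      simp only [e] at h1
      have h3 := mul_le_mul_of_nonpos_left h2 hxy.le
      have h4 : s ^ 2 * (p.1 ^ 2 + p.2 ^ 2 + p.1 * p.2 * φ (s * p.1, s * p.2)) ≤ 0 :=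
        mul_nonpos_of_nonneg_of_nonpos (sq_nonneg s) (by linarith)
      linarith
    have hmp : p ∈ ((fun s : ℝ => s • p) '' Ici 1) := ⟨1, mem_Ici.2 le_rfl, one_smul _ _⟩
    have hp0 : 0 < ‖p‖ := norm_pos_iff.2 (by rintro rfl; simp at hxy)
    rcases hp.1 with h | h
    · have hb := h.2.subset (hpre.subset_connectedComponentIn hmp hsub)
      obtain ⟨R, hR0, hR⟩ := hb.exists_pos_norm_le
      have h5 := hR _ ⟨1 + R / ‖p‖, (by
        have : 0 ≤ R / ‖p‖ := by positivity
        rw [mem_Ici]; linarith), rfl⟩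
      simp only at h5
      rw [norm_smul, Real.norm_of_nonneg (by positivity), add_mul, div_mul_cancel₀ _ hp0.ne'] at h5
      linarith
    · exact hsub hmp h
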